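/- arXiv:math/0602426 — 3 statements merged into one kernel-verified Lean document; each statement's English description precedes it below -/
import Mathlib

section
/- Fix 1 < p < ∞, let p′ = p/(p−1), and let 1 ≤ q ≤ ∞. If f : (0,∞) → ℝ is measurable and ∫₀^∞ |f(t)|·t^{−1/p′} dt < ∞, then S|f| ∈ L^{p,q}(0,∞); that is, ∫₀^∞ s^{q−1}·λ_{S|f|}(s)^{q/p} ds < ∞ when q < ∞, and sup_{s>0} s·λ_{S|f|}(s)^{1/p} < ∞ when q = ∞. -/
open MeasureTheory Set
open scoped ENNReal

/-- The Hardy operator `S f (x) = (1/x) ∫₀ˣ f(y) dy`. -/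
noncomputable def S (f : ℝ → ℝ) (x : ℝ) : ℝ := (1 / x) * ∫ y in Ioo (0 : ℝ) x, f y

/-- The distribution function `λ_g(s) = |{x ∈ (0,∞) : |g(x)| > s}|`. -/
noncomputable def distFn (g : ℝ → ℝ) (s : ℝ) : ℝ≥0∞ :=
  volume {x | x ∈ Ioi (0 : ℝ) ∧ s < |g x|}

/-- A decreasing majorant of the Hardy average of `|f|`. -/
noncomputable def hardyMajorant (f : ℝ → ℝ) (x : ℝ) : ℝ≥0∞ :=
  ∫⁻ y in Ioi (0 : ℝ), ENNReal.ofReal (|f y| * (max x y)⁻¹)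

lemma hardyMajorant_antitoneOn (f : ℝ → ℝ) : AntitoneOn (hardyMajorant f) (Ioi 0) := by
  intro x hx z _ hxz
  have hx' : (0 : ℝ) < x := hx
  refine lintegral_mono fun y => ENNReal.ofReal_le_ofReal ?_
  have : 0 < max x y := lt_max_of_lt_left hx'
  gcongr

lemma measurable_hardyMajorant {f : ℝ → ℝ} (hf : Measurable f) :
    Measurable (hardyMajorant f) := by
  unfold hardyMajorant
  refine Measurable.lintegral_prod_right' (ν := volume.restrict (Ioi (0 : ℝ)))
    (f := fun z : ℝ × ℝ => ENNReal.ofReal (|f z.2| * (max z.1 z.2)⁻¹)) ?_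
  have hsnd : Measurable fun z : ℝ × ℝ => f z.2 := hf.comp measurable_snd
  exact (hsnd.abs.mul (measurable_fst.max measurable_snd).inv).ennreal_ofReal

lemma ofReal_abs_S_le_hardyMajorant (f : ℝ → ℝ) {x : ℝ} (hx : 0 < x) :
    ENNReal.ofReal |S (fun y => |f y|) x| ≤ hardyMajorant f x := by
  unfold S hardyMajorant
  rw [abs_mul, ENNReal.ofReal_mul (abs_nonneg _), abs_of_pos (by positivity : 0 < 1 / x),
    ← Real.norm_eq_abs (∫ y in Ioo (0 : ℝ) x, |f y|), ofReal_norm]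
  calc ENNReal.ofReal (1 / x) * ‖∫ y in Ioo (0 : ℝ) x, |f y|‖ₑ
      ≤ ENNReal.ofReal (1 / x) * ∫⁻ y in Ioo (0 : ℝ) x, ‖|f y|‖ₑ := by
        gcongr; exact enorm_integral_le_lintegral_enorm _
    _ = ∫⁻ y in Ioo (0 : ℝ) x, ENNReal.ofReal (1 / x) * ‖|f y|‖ₑ :=
        (lintegral_const_mul' _ _ ENNReal.ofReal_ne_top).symm
    _ = ∫⁻ y in Ioo (0 : ℝ) x, ENNReal.ofReal (|f y| * (max x y)⁻¹) := by
        refine setLIntegral_congr_fun measurableSet_Ioo fun y hy => ?_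
        rw [max_eq_left hy.2.le, mul_comm, ENNReal.ofReal_mul (abs_nonneg _), one_div,
          Real.enorm_eq_ofReal (abs_nonneg _)]
    _ ≤ _ := lintegral_mono_set Ioo_subset_Ioi_self

lemma hardyMajorant_le (f : ℝ → ℝ) {a x : ℝ} (ha : 0 < a) (ha1 : a < 1) (hx : 0 < x) :
    hardyMajorant f x ≤ ENNReal.ofReal (x ^ (-a)) *
      ∫⁻ y in Ioi (0 : ℝ), ENNReal.ofReal (|f y| * y ^ (a - 1)) := by
  unfold hardyMajorant
  rw [← lintegral_const_mul' _ _ ENNReal.ofReal_ne_top]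
  refine setLIntegral_mono' measurableSet_Ioi fun y hy => ?_
  have hy' : (0 : ℝ) < y := hy
  rw [← ENNReal.ofReal_mul (by positivity)]
  refine ENNReal.ofReal_le_ofReal ?_
  have hm : 0 < max x y := lt_max_of_lt_left hx
  have key : (max x y)⁻¹ ≤ x ^ (-a) * y ^ (a - 1) := by
    calc (max x y)⁻¹ = (max x y) ^ (-a) * (max x y) ^ (a - 1) := by
          rw [← Real.rpow_add hm, ← Real.rpow_neg_one]; congr 1; ring
      _ ≤ x ^ (-a) * y ^ (a - 1) := by
          exact mul_le_mul
            (Real.rpow_le_rpow_of_nonpos hx (le_max_left _ _) (by linarith))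
            (Real.rpow_le_rpow_of_nonpos hy' (le_max_right _ _) (by linarith))
            (by positivity) (by positivity)
  calc |f y| * (max x y)⁻¹ ≤ |f y| * (x ^ (-a) * y ^ (a - 1)) := by gcongr
    _ = _ := by ring

lemma lintegral_Ioo_rpow {a b : ℝ} (ha : 0 < a) (hb : 0 ≤ b) :
    ∫⁻ x in Ioo (0 : ℝ) b, ENNReal.ofReal (x ^ (a - 1)) = ENNReal.ofReal (b ^ a / a) := by
  rw [Measure.restrict_congr_set Ioo_ae_eq_Ioc, ← ofReal_integral_eq_lintegral_ofReal]
  · rw [← intervalIntegral.integral_of_le hb, integral_rpow (Or.inl (by linarith))]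
    simp [Real.zero_rpow ha.ne']
  · exact (intervalIntegrable_iff_integrableOn_Ioc_of_le hb).1
      (intervalIntegral.intervalIntegrable_rpow' (by linarith))
  · exact (ae_restrict_mem measurableSet_Ioc).mono fun x hx => Real.rpow_nonneg hx.1.le _

lemma lintegral_Ioi_rpow {a b : ℝ} (ha : a < 1) (hb : 0 < b) :
    ∫⁻ x in Ioi b, ENNReal.ofReal (x ^ (a - 2)) = ENNReal.ofReal (b ^ (a - 1) / (1 - a)) := by
  rw [← ofReal_integral_eq_lintegral_ofReal]
  · rw [integral_Ioi_rpow_of_lt (by linarith) hb]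
    congr 1
    rw [show a - 2 + 1 = -(1 - a) by ring, show a - 1 = -(1 - a) by ring, neg_div_neg_eq]
  · exact integrableOn_Ioi_rpow_of_lt (by linarith) hb
  · exact (ae_restrict_mem measurableSet_Ioi).mono fun x hx => Real.rpow_nonneg (hb.trans hx).le _

lemma lintegral_rpow_mul_inv_max {a y : ℝ} (ha : 0 < a) (ha1 : a < 1) (hy : 0 < y) :
    ∫⁻ x in Ioi (0 : ℝ), ENNReal.ofReal (x ^ (a - 1) * (max x y)⁻¹) =
      ENNReal.ofReal ((1 / a + 1 / (1 - a)) * y ^ (a - 1)) := by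
  have h1 : ∫⁻ x in Ioc (0 : ℝ) y, ENNReal.ofReal (x ^ (a - 1) * (max x y)⁻¹) =
      ENNReal.ofReal (1 / a * y ^ (a - 1)) := by
    rw [setLIntegral_congr_fun measurableSet_Ioc
      (g := fun x => ENNReal.ofReal (x ^ (a - 1)) * ENNReal.ofReal y⁻¹),
      lintegral_mul_const' _ _ ENNReal.ofReal_ne_top,
      ← Measure.restrict_congr_set Ioo_ae_eq_Ioc, lintegral_Ioo_rpow ha hy.le,
      ← ENNReal.ofReal_mul (by positivity), Real.rpow_sub_one hy.ne']
    · congr 1; ring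
    · intro x hx
      simp only
      rw [max_eq_right hx.2, ENNReal.ofReal_mul (Real.rpow_nonneg hx.1.le _)]
  have h2 : ∫⁻ x in Ioi y, ENNReal.ofReal (x ^ (a - 1) * (max x y)⁻¹) =
      ENNReal.ofReal (1 / (1 - a) * y ^ (a - 1)) := by
    rw [setLIntegral_congr_fun measurableSet_Ioi
      (g := fun x => ENNReal.ofReal (x ^ (a - 2))), lintegral_Ioi_rpow ha1 hy]
    · congr 1; ring
    · intro x hx
      have hx0 : 0 < x := hy.trans hx
      simp only
      rw [max_eq_left (le_of_lt hx), ← Real.rpow_neg_one x, ← Real.rpow_add hx0]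
      congr 2; ring
  have : 0 < 1 - a := by linarith
  rw [← Ioc_union_Ioi_eq_Ioi hy.le, lintegral_union measurableSet_Ioi
    (Ioc_disjoint_Ioi le_rfl), h1, h2, ← ENNReal.ofReal_add (by positivity) (by positivity),
    add_mul]

lemma lintegral_rpow_mul_hardyMajorant {f : ℝ → ℝ} (hf : Measurable f) {a : ℝ} (ha : 0 < a)
    (ha1 : a < 1) :
    ∫⁻ x in Ioi (0 : ℝ), ENNReal.ofReal (x ^ (a - 1)) * hardyMajorant f x =
      ENNReal.ofReal (1 / a + 1 / (1 - a)) *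
        ∫⁻ y in Ioi (0 : ℝ), ENNReal.ofReal (|f y| * y ^ (a - 1)) := by
  have : 0 < 1 - a := by linarith
  unfold hardyMajorant
  simp_rw [← lintegral_const_mul' _ _ ENNReal.ofReal_ne_top]
  rw [lintegral_lintegral_swap]
  · refine setLIntegral_congr_fun measurableSet_Ioi fun y hy => ?_
    have hy' : (0 : ℝ) < y := hy
    rw [setLIntegral_congr_fun measurableSet_Ioi (g := fun x => ENNReal.ofReal |f y| *
      ENNReal.ofReal (x ^ (a - 1) * (max x y)⁻¹)),
      lintegral_const_mul' _ _ ENNReal.ofReal_ne_top, lintegral_rpow_mul_inv_max ha ha1 hy',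
      ← ENNReal.ofReal_mul (abs_nonneg _), ← ENNReal.ofReal_mul (by positivity)]
    · congr 1; ring
    · intro x hx
      have hx' : (0 : ℝ) < x := hx
      simp only
      rw [← ENNReal.ofReal_mul (by positivity), ← ENNReal.ofReal_mul (abs_nonneg _)]
      congr 1; ring
  · have h2 : Measurable fun z : ℝ × ℝ => f z.2 := hf.comp measurable_snd
    have h1 : Measurable fun z : ℝ × ℝ => z.1 ^ (a - 1) := measurable_fst.pow_const _
    exact (h1.ennreal_ofReal.mul
      (h2.abs.mul (measurable_fst.max measurable_snd).inv).ennreal_ofReal).aemeasurable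

/-- An initial interval `A` of `(0,∞)` satisfies `|A| ^ a ≤ a ∫_A x ^ (a - 1) dx`. -/
lemma volume_rpow_le_lintegral {A : Set ℝ} {a : ℝ} (ha : 0 < a) (hA : A ⊆ Ioi 0)
    (hdown : ∀ x ∈ A, ∀ z, 0 < z → z ≤ x → z ∈ A) :
    volume A ^ a ≤ ENNReal.ofReal a * ∫⁻ x in A, ENNReal.ofReal (x ^ (a - 1)) := by
  refine ENNReal.le_of_forall_nnreal_lt fun r hr => ?_
  have hr' : (r : ℝ≥0∞) ^ (1 / a) < volume A := by
    have := ENNReal.rpow_lt_rpow hr (by positivity : 0 < 1 / a)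
    rwa [← ENNReal.rpow_mul, mul_one_div_cancel ha.ne', ENNReal.rpow_one] at this
  have hsub : Ioo (0 : ℝ) ((r : ℝ) ^ (1 / a)) ⊆ A := by
    intro x hx
    by_contra hxA
    have hAx : A ⊆ Ioo 0 x := fun z hz => ⟨hA hz, by
      by_contra! h
      exact hxA (hdown z hz x hx.1 h)⟩
    have h1 := (measure_mono hAx).trans_eq (Real.volume_Ioo (a := 0) (b := x))
    have h2 : ENNReal.ofReal (x - 0) ≤ (r : ℝ≥0∞) ^ (1 / a) := by
      rw [← ENNReal.ofReal_coe_nnreal, ENNReal.ofReal_rpow_of_nonneg r.coe_nonneg (by positivity),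
        sub_zero]
      exact ENNReal.ofReal_le_ofReal hx.2.le
    exact absurd hr' (not_lt.2 (h1.trans h2))
  calc (r : ℝ≥0∞) = ENNReal.ofReal a *
        ∫⁻ x in Ioo (0 : ℝ) ((r : ℝ) ^ (1 / a)), ENNReal.ofReal (x ^ (a - 1)) := by
        rw [lintegral_Ioo_rpow ha (by positivity), ← ENNReal.ofReal_mul ha.le,
          ← Real.rpow_mul r.coe_nonneg, one_div_mul_cancel ha.ne', Real.rpow_one,
          mul_div_cancel₀ _ ha.ne', ENNReal.ofReal_coe_nnreal]
    _ ≤ _ := by gcongr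

lemma volume_ofReal_lt_le (c : ℝ≥0∞) :
    volume ({s : ℝ | ENNReal.ofReal s < c} ∩ Ioi 0) ≤ c := by
  induction c with
  | top => exact le_top
  | coe r =>
    have : {s : ℝ | ENNReal.ofReal s < r} ∩ Ioi 0 ⊆ Ioo 0 (r : ℝ) := fun s hs => ⟨hs.2, by
      have h := hs.1
      rw [mem_ofPred_eq, ← ENNReal.ofReal_coe_nnreal, ENNReal.ofReal_lt_ofReal_iff'] at h
      exact h.1⟩
    refine (measure_mono this).trans_eq ?_
    simp

/-- The layer cake bound for the level sets of a decreasing function on `(0,∞)`. -/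
lemma lintegral_volume_rpow_le {h : ℝ → ℝ≥0∞} (hm : Measurable h) (hanti : AntitoneOn h (Ioi 0))
    {a : ℝ} (ha : 0 < a) :
    ∫⁻ s in Ioi (0 : ℝ), volume {x | x ∈ Ioi (0 : ℝ) ∧ ENNReal.ofReal s < h x} ^ a ≤
      ENNReal.ofReal a * ∫⁻ x in Ioi (0 : ℝ), ENNReal.ofReal (x ^ (a - 1)) * h x := by
  have hset : MeasurableSet {z : ℝ × ℝ | ENNReal.ofReal z.1 < h z.2} :=
    measurableSet_lt (by fun_prop) (by fun_prop)
  have hsec (s : ℝ) : MeasurableSet {x : ℝ | ENNReal.ofReal s < h x} :=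
    measurableSet_lt measurable_const hm
  have hsec' (x : ℝ) : MeasurableSet {s : ℝ | ENNReal.ofReal s < h x} :=
    measurableSet_lt (by fun_prop) measurable_const
  calc ∫⁻ s in Ioi (0 : ℝ), volume {x | x ∈ Ioi (0 : ℝ) ∧ ENNReal.ofReal s < h x} ^ a
      ≤ ∫⁻ s in Ioi (0 : ℝ), ENNReal.ofReal a * ∫⁻ x in Ioi (0 : ℝ),
          {z : ℝ × ℝ | ENNReal.ofReal z.1 < h z.2}.indicator
            (fun z => ENNReal.ofReal (z.2 ^ (a - 1))) (s, x) := by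
        refine lintegral_mono fun s => ?_
        refine (volume_rpow_le_lintegral
          (A := {x | x ∈ Ioi (0 : ℝ) ∧ ENNReal.ofReal s < h x}) ha (fun x hx => hx.1)
          fun x hx z hz hzx => ⟨hz, hx.2.trans_le (hanti hz hx.1 hzx)⟩).trans_eq ?_
        congr 1
        have : {x | x ∈ Ioi (0 : ℝ) ∧ ENNReal.ofReal s < h x} =
          {x : ℝ | ENNReal.ofReal s < h x} ∩ Ioi 0 := by ext x; exact and_comm
        rw [this, ← Measure.restrict_restrict (hsec s), ← lintegral_indicator (hsec s)]
        rfl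
    _ = ENNReal.ofReal a * ∫⁻ x in Ioi (0 : ℝ), ∫⁻ s in Ioi (0 : ℝ),
          {z : ℝ × ℝ | ENNReal.ofReal z.1 < h z.2}.indicator
            (fun z => ENNReal.ofReal (z.2 ^ (a - 1))) (s, x) := by
        rw [lintegral_const_mul' _ _ ENNReal.ofReal_ne_top, lintegral_lintegral_swap]
        exact (Measurable.indicator (measurable_snd.pow_const _).ennreal_ofReal hset).aemeasurable
    _ ≤ _ := by
        gcongr with x
        calc ∫⁻ s in Ioi (0 : ℝ), {z : ℝ × ℝ | ENNReal.ofReal z.1 < h z.2}.indicator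
                (fun z => ENNReal.ofReal (z.2 ^ (a - 1))) (s, x)
            = ∫⁻ s in Ioi (0 : ℝ), {s : ℝ | ENNReal.ofReal s < h x}.indicator
                (fun _ => ENNReal.ofReal (x ^ (a - 1))) s := rfl
          _ = ENNReal.ofReal (x ^ (a - 1)) *
                volume ({s : ℝ | ENNReal.ofReal s < h x} ∩ Ioi 0) := by
              rw [lintegral_indicator_const (hsec' x), Measure.restrict_apply (hsec' x)]
          _ ≤ _ := by gcongr; exact volume_ofReal_lt_le _

lemma distFn_S_le (f : ℝ → ℝ) {s : ℝ} (hs : 0 < s) :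
    distFn (fun x => S (fun y => |f y|) x) s ≤
      volume {x | x ∈ Ioi (0 : ℝ) ∧ ENNReal.ofReal s < hardyMajorant f x} :=
  measure_mono fun _ hx => ⟨hx.1, (ENNReal.ofReal_lt_ofReal_iff (hs.trans hx.2)).2 hx.2 |>.trans_le
    (ofReal_abs_S_le_hardyMajorant f hx.1)⟩

lemma ofReal_mul_distFn_S_rpow_le (f : ℝ → ℝ) {a s : ℝ} (ha : 0 < a) (ha1 : a < 1) (hs : 0 < s) :
    ENNReal.ofReal s * distFn (fun x => S (fun y => |f y|) x) s ^ a ≤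
      ∫⁻ y in Ioi (0 : ℝ), ENNReal.ofReal (|f y| * y ^ (a - 1)) := by
  have hbound := fun x (hx : 0 < x) => hardyMajorant_le f ha ha1 hx
  generalize (∫⁻ y in Ioi (0 : ℝ), ENNReal.ofReal (|f y| * y ^ (a - 1))) = W at hbound ⊢
  induction W with
  | top => exact le_top
  | coe r =>
    have hsub : {x | x ∈ Ioi (0 : ℝ) ∧ ENNReal.ofReal s < hardyMajorant f x} ⊆
        Ioo 0 ((r / s : ℝ) ^ (1 / a)) := by
      rintro x ⟨hx, hlt⟩
      have hx' : (0 : ℝ) < x := hx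
      refine ⟨hx, ?_⟩
      have h1 := hlt.trans_le (hbound x hx)
      rw [← ENNReal.ofReal_coe_nnreal, ← ENNReal.ofReal_mul (by positivity),
        ENNReal.ofReal_lt_ofReal_iff_of_nonneg hs.le, Real.rpow_neg hx'.le, inv_mul_eq_div,
        lt_div_iff₀ (by positivity)] at h1
      have h2 : x ^ a < r / s := by rwa [lt_div_iff₀ hs, mul_comm]
      have h3 := Real.rpow_lt_rpow (by positivity) h2 (by positivity : 0 < 1 / a)
      rwa [← Real.rpow_mul hx'.le, mul_one_div_cancel ha.ne', Real.rpow_one] at h3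
    have hvol := (distFn_S_le f hs).trans (measure_mono hsub)
    rw [Real.volume_Ioo, sub_zero] at hvol
    calc ENNReal.ofReal s * distFn (fun x => S (fun y => |f y|) x) s ^ a
        ≤ ENNReal.ofReal s * ENNReal.ofReal ((r / s : ℝ) ^ (1 / a)) ^ a := by gcongr
      _ = r := by
        rw [ENNReal.ofReal_rpow_of_nonneg (by positivity) ha.le, ← Real.rpow_mul (by positivity),
          one_div_mul_cancel ha.ne', Real.rpow_one, ← ENNReal.ofReal_mul hs.le,
          mul_div_cancel₀ _ hs.ne', ENNReal.ofReal_coe_nnreal]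

lemma lintegral_distFn_S_rpow_le {f : ℝ → ℝ} (hf : Measurable f) {a : ℝ} (ha : 0 < a)
    (ha1 : a < 1) :
    ∫⁻ s in Ioi (0 : ℝ), distFn (fun x => S (fun y => |f y|) x) s ^ a ≤
      ENNReal.ofReal a * (ENNReal.ofReal (1 / a + 1 / (1 - a)) *
        ∫⁻ y in Ioi (0 : ℝ), ENNReal.ofReal (|f y| * y ^ (a - 1))) := by
  rw [← lintegral_rpow_mul_hardyMajorant hf ha ha1]
  refine le_trans (setLIntegral_mono' measurableSet_Ioi fun s hs => ?_)
    (lintegral_volume_rpow_le (measurable_hardyMajorant hf) (hardyMajorant_antitoneOn f) ha)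
  gcongr
  exact distFn_S_le f hs

/-- For `1 < p < ∞`, `p' = p/(p-1)` and `1 ≤ q ≤ ∞`: if `∫₀^∞ |f(t)|·t^{-1/p'} dt < ∞`,
then `S|f| ∈ L^{p,q}(0,∞)`; i.e. `∫₀^∞ s^{q-1}·λ_{S|f|}(s)^{q/p} ds < ∞` for every
`1 ≤ q < ∞`, and `sup_{s>0} s·λ_{S|f|}(s)^{1/p} < ∞` (the case `q = ∞`). -/
theorem weighted_L1_subset_hardy_domain_Lpq (p p' : ℝ) (hp : 1 < p)
    (hp' : p' = p / (p - 1)) (f : ℝ → ℝ) (hfmeas : Measurable f)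
    (hf : (∫⁻ t in Ioi (0 : ℝ), ENNReal.ofReal (|f t| * t ^ (-(1 / p')))) < ⊤) :
    (∀ q : ℝ, 1 ≤ q →
      (∫⁻ s in Ioi (0 : ℝ), ENNReal.ofReal (s ^ (q - 1)) *
        (distFn (fun x => S (fun y => |f y|) x) s) ^ (q / p)) < ⊤) ∧
    (⨆ s ∈ Ioi (0 : ℝ), ENNReal.ofReal s *
        (distFn (fun x => S (fun y => |f y|) x) s) ^ (1 / p)) < ⊤ := by
  have hp0 : 0 < p := by linarith
  have ha : 0 < 1 / p := by positivity
  have ha1 : 1 / p < 1 := by rw [div_lt_one hp0]; exact hp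
  have hexp : -(1 / p') = 1 / p - 1 := by
    rw [hp']; field_simp; ring
  rw [hexp] at hf
  refine ⟨fun q hq => ?_, ?_⟩
  · set W := ∫⁻ t in Ioi (0 : ℝ), ENNReal.ofReal (|f t| * t ^ (1 / p - 1))
    have hWq : W ^ (q - 1) ≠ ⊤ := ENNReal.rpow_ne_top_of_nonneg (by linarith) hf.ne
    have hq1 : 0 ≤ q - 1 := by linarith
    calc ∫⁻ s in Ioi (0 : ℝ), ENNReal.ofReal (s ^ (q - 1)) *
          (distFn (fun x => S (fun y => |f y|) x) s) ^ (q / p)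
        ≤ ∫⁻ s in Ioi (0 : ℝ), W ^ (q - 1) *
          (distFn (fun x => S (fun y => |f y|) x) s) ^ (1 / p) := by
          refine setLIntegral_mono' measurableSet_Ioi fun s hs => ?_
          have hs' : (0 : ℝ) < s := hs
          rw [show q / p = 1 / p * (q - 1) + 1 / p by ring,
            ENNReal.rpow_add_of_nonneg _ _ (by positivity) ha.le, ENNReal.rpow_mul,
            ← ENNReal.ofReal_rpow_of_nonneg hs'.le hq1, ← mul_assoc,
            ← ENNReal.mul_rpow_of_nonneg _ _ hq1]
          gcongr
          exact ofReal_mul_distFn_S_rpow_le f ha ha1 hs'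
      _ = W ^ (q - 1) * ∫⁻ s in Ioi (0 : ℝ),
          (distFn (fun x => S (fun y => |f y|) x) s) ^ (1 / p) := lintegral_const_mul' _ _ hWq
      _ < ⊤ := by
          refine ENNReal.mul_lt_top hWq.lt_top ?_
          exact (lintegral_distFn_S_rpow_le hfmeas ha ha1).trans_lt
            (ENNReal.mul_lt_top ENNReal.ofReal_lt_top (ENNReal.mul_lt_top ENNReal.ofReal_lt_top hf))
  · exact (iSup₂_le fun s (hs : s ∈ Ioi (0 : ℝ)) => ofReal_mul_distFn_S_rpow_le f ha ha1 hs).trans_lt hf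
end

section
/- Fix 1 < p < ∞ and 1 < q ≤ ∞. There does NOT exist a nonnegative locally integrable function v on (0,∞) such that for every measurable f : (0,∞) → ℝ one has: S|f| ∈ L^{p,q}(0,∞) if and only if ∫₀^∞ |f(t)|·v(t) dt < ∞. That is, the optimal domain [S, L^{p,q}] is not a weighted L¹ space for any 1 < q ≤ ∞. -/
open MeasureTheory Set
open scoped ENNReal

/-- Membership in the Lorentz space `L^{p,q}(0,∞)` (with `q = ⊤` allowed), expressed via
the distribution function. -/
noncomputable def MemLpq (p : ℝ) (q : ℝ≥0∞) (g : ℝ → ℝ) : Prop :=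
  if q = ⊤ then (⨆ s ∈ Ioi (0 : ℝ), ENNReal.ofReal s * (distFn g s) ^ (1 / p)) < ⊤
  else (∫⁻ s in Ioi (0 : ℝ),
    ENNReal.ofReal (s ^ (q.toReal - 1)) * (distFn g s) ^ (q.toReal / p)) < ⊤

theorem distFn_antitone (g : ℝ → ℝ) : Antitone (distFn g) := fun _ _ hst =>
  measure_mono fun _ hx => ⟨hx.1, hst.trans_lt hx.2⟩

theorem MemLpq.exists_weak_bound {p : ℝ} {q : ℝ≥0∞} (hp : 0 < p) (hq : 1 < q) {g : ℝ → ℝ}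
    (h : MemLpq p q g) :
    ∃ C : ℝ≥0∞, C < ⊤ ∧ ∀ s > 0, ENNReal.ofReal s * distFn g s ^ (1 / p) ≤ C := by
  unfold MemLpq at h
  split_ifs at h with hqt
  · exact ⟨_, h, fun s hs => le_iSup₂_of_le s hs le_rfl⟩
  · set Q := q.toReal
    have hQ : 1 < Q := by
      rw [← ENNReal.toReal_one]
      exact (ENNReal.toReal_lt_toReal (by simp) hqt).2 hq
    have hQ0 : 0 < Q := by linarith
    refine ⟨2 * _ ^ (1 / Q), ENNReal.mul_lt_top (by simp)
      (ENNReal.rpow_lt_top_of_nonneg (by positivity) h.ne), fun s hs => ?_⟩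
    have hs2 : 0 < s / 2 := by positivity
    have key : (ENNReal.ofReal (s / 2) * distFn g s ^ (1 / p)) ^ Q ≤
        ∫⁻ r in Ioi (0 : ℝ), ENNReal.ofReal (r ^ (Q - 1)) * distFn g r ^ (Q / p) := by
      calc (ENNReal.ofReal (s / 2) * distFn g s ^ (1 / p)) ^ Q
          = ENNReal.ofReal ((s / 2) ^ (Q - 1)) * distFn g s ^ (Q / p) *
              volume (Ioc (s / 2) s) := by
            rw [ENNReal.mul_rpow_of_nonneg _ _ hQ0.le, ← ENNReal.rpow_mul, Real.volume_Ioc,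
              ENNReal.ofReal_rpow_of_pos hs2, show s - s / 2 = s / 2 by ring,
              mul_right_comm, ← ENNReal.ofReal_mul (by positivity),
              ← Real.rpow_add_one hs2.ne', sub_add_cancel, one_div_mul_eq_div]
        _ = ∫⁻ _ in Ioc (s / 2) s,
              ENNReal.ofReal ((s / 2) ^ (Q - 1)) * distFn g s ^ (Q / p) := by
            rw [setLIntegral_const]
        _ ≤ ∫⁻ r in Ioc (s / 2) s, ENNReal.ofReal (r ^ (Q - 1)) * distFn g r ^ (Q / p) := by
            refine setLIntegral_mono' measurableSet_Ioc fun r hr => ?_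
            refine mul_le_mul' (ENNReal.ofReal_le_ofReal ?_) ?_
            · exact Real.rpow_le_rpow hs2.le hr.1.le (by linarith)
            · exact ENNReal.rpow_le_rpow (distFn_antitone g hr.2) (by positivity)
        _ ≤ _ := lintegral_mono_set fun r hr => hs2.trans hr.1
    have := (ENNReal.le_rpow_inv_iff hQ0).2 key
    calc ENNReal.ofReal s * distFn g s ^ (1 / p)
        = 2 * (ENNReal.ofReal (s / 2) * distFn g s ^ (1 / p)) := by
          rw [← mul_assoc, ← ENNReal.ofReal_ofNat, ← ENNReal.ofReal_mul (by norm_num)]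
          congr 3; ring
      _ ≤ _ := by
          rw [one_div Q]
          gcongr

/-- The function on `[1, ∞)` equal to `c k` on each `[2 ^ k, 2 ^ (k + 1))`, and `0` elsewhere. -/
noncomputable def dyadicStep (c : ℕ → ℝ) (t : ℝ) : ℝ :=
  if 1 ≤ t then c (Nat.log 2 ⌊t⌋₊) else 0

/-- The dyadic interval `[2 ^ k, 2 ^ (k + 1))`. -/
def dyadicIco (k : ℕ) : Set ℝ := Ico (2 ^ k) (2 ^ (k + 1))

theorem measurableSet_dyadicIco (k : ℕ) : MeasurableSet (dyadicIco k) := measurableSet_Ico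

theorem dyadicIco_subset_Ioi (k : ℕ) : dyadicIco k ⊆ Ioi 0 := fun _ ht =>
  lt_of_lt_of_le (by positivity) ht.1

theorem one_le_of_mem_dyadicIco {k : ℕ} {t : ℝ} (ht : t ∈ dyadicIco k) : 1 ≤ t :=
  (one_le_pow₀ (by norm_num)).trans ht.1

theorem log_floor_of_mem_dyadicIco {k : ℕ} {t : ℝ} (ht : t ∈ dyadicIco k) :
    Nat.log 2 ⌊t⌋₊ = k := by
  have h0 : 0 ≤ t := zero_le_one.trans (one_le_of_mem_dyadicIco ht)
  refine Nat.log_eq_of_pow_le_of_lt_pow ?_ ?_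
  · exact Nat.le_floor (by exact_mod_cast ht.1)
  · exact (Nat.floor_lt h0).2 (by exact_mod_cast ht.2)

theorem mem_dyadicIco_log_floor {t : ℝ} (ht : 1 ≤ t) : t ∈ dyadicIco (Nat.log 2 ⌊t⌋₊) := by
  have h0 : 0 ≤ t := zero_le_one.trans ht
  have h1 : ⌊t⌋₊ ≠ 0 := (Nat.floor_pos.2 ht).ne'
  constructor
  · exact le_trans (by exact_mod_cast Nat.pow_log_le_self 2 h1) (Nat.floor_le h0)
  · exact_mod_cast (Nat.floor_lt h0).1 (Nat.lt_pow_succ_log_self one_lt_two ⌊t⌋₊)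

theorem pairwise_disjoint_dyadicIco : Pairwise (Function.onFun Disjoint dyadicIco) := by
  intro i j hij
  refine Set.disjoint_left.2 fun t hi hj => hij ?_
  rw [← log_floor_of_mem_dyadicIco hi, log_floor_of_mem_dyadicIco hj]

theorem iUnion_dyadicIco : ⋃ k, dyadicIco k = Ici 1 := by
  ext t
  simp only [mem_iUnion, mem_Ici]
  exact ⟨fun ⟨_, h⟩ => one_le_of_mem_dyadicIco h, fun h => ⟨_, mem_dyadicIco_log_floor h⟩⟩

theorem setLIntegral_Ici_one_eq_tsum (F : ℝ → ℝ≥0∞) :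
    ∫⁻ t in Ici 1, F t = ∑' k, ∫⁻ t in dyadicIco k, F t := by
  rw [← iUnion_dyadicIco, lintegral_iUnion measurableSet_dyadicIco pairwise_disjoint_dyadicIco]

theorem dyadicStep_of_mem (c : ℕ → ℝ) {k : ℕ} {t : ℝ} (ht : t ∈ dyadicIco k) :
    dyadicStep c t = c k := by
  rw [dyadicStep, if_pos (one_le_of_mem_dyadicIco ht), log_floor_of_mem_dyadicIco ht]

theorem measurable_dyadicStep (c : ℕ → ℝ) : Measurable (dyadicStep c) :=
  Measurable.ite measurableSet_Ici
    ((measurable_from_top (f := fun n : ℕ => c (Nat.log 2 n))).comp Nat.measurable_floor)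
    measurable_const

theorem dyadicStep_nonneg {c : ℕ → ℝ} (hc : ∀ k, 0 ≤ c k) (t : ℝ) : 0 ≤ dyadicStep c t := by
  unfold dyadicStep
  split_ifs
  exacts [hc _, le_rfl]

theorem integrableOn_dyadicStep (c : ℕ → ℝ) (x : ℝ) :
    IntegrableOn (dyadicStep c) (Ioo 0 x) := by
  refine IntegrableOn.of_bound (by simp) (measurable_dyadicStep c).aestronglyMeasurable
    (∑ k ∈ Finset.range (Nat.log 2 ⌊x⌋₊ + 1), |c k|) ?_
  refine (ae_restrict_iff' measurableSet_Ioo).2 (.of_forall fun t ht => ?_)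
  unfold dyadicStep
  split_ifs
  · refine Finset.single_le_sum (f := fun k => |c k|) (fun _ _ => abs_nonneg _) ?_
    exact Finset.mem_range_succ_iff.2 (Nat.log_mono_right (Nat.floor_mono ht.2.le))
  · simpa using Finset.sum_nonneg fun _ _ => abs_nonneg _

theorem le_S_dyadicStep {c : ℕ → ℝ} (hc : ∀ k, 0 ≤ c k) {k : ℕ} {x : ℝ}
    (hx : x ∈ dyadicIco (k + 1)) : c k / 4 ≤ S (fun y => |dyadicStep c y|) x := by
  have hx0 : 0 < x := dyadicIco_subset_Ioi _ hx
  have hint : c k * 2 ^ k ≤ ∫ y in Ioo 0 x, |dyadicStep c y| := by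
    calc c k * 2 ^ k = ∫ y in dyadicIco k, |dyadicStep c y| := by
          rw [setIntegral_congr_fun (measurableSet_dyadicIco k) (g := fun _ => c k)
            fun t ht => by simp only [dyadicStep_of_mem c ht, abs_of_nonneg (hc k)]]
          simp only [dyadicIco, integral_const, MeasurableSet.univ, measureReal_restrict_apply,
            univ_inter, Real.volume_real_Ico, smul_eq_mul]
          rw [max_eq_left (by rw [pow_succ]; linarith [pow_pos (two_pos : (0 : ℝ) < 2) k])]
          ring
      _ ≤ _ := by
          refine setIntegral_mono_set (integrableOn_dyadicStep c x).abs
            (.of_forall fun _ => abs_nonneg _) (LE.le.eventuallyLE ?_)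
          exact fun t (ht : t ∈ dyadicIco k) => ⟨dyadicIco_subset_Ioi _ ht, ht.2.trans_le hx.1⟩
  have hx2 : x ≤ 4 * 2 ^ k := hx.2.le.trans (by rw [pow_succ, pow_succ]; linarith)
  rw [S, one_div_mul_eq_div, le_div_iff₀ hx0]
  refine le_trans ?_ hint
  nlinarith [hc k]

theorem not_memLpq_S_dyadicStep {p : ℝ} {q : ℝ≥0∞} (hp : 0 < p) (hq : 1 < q) {b : ℕ → ℝ}
    (hb : ∀ k, 0 ≤ b k) (hunb : ∀ N : ℕ, ∃ k, (N : ℝ) ≤ b k) :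
    ¬ MemLpq p q (fun x => S (fun y => |dyadicStep (fun k => b k * 2 ^ (-(k : ℝ) / p)) y|) x) := by
  intro h
  obtain ⟨C, hC, hbound⟩ := h.exists_weak_bound hp hq
  set c : ℕ → ℝ := fun k => b k * 2 ^ (-(k : ℝ) / p)
  have hc : ∀ k, 0 ≤ c k := fun k => mul_nonneg (hb k) (by positivity)
  have hle : ∀ k, 0 < b k → b k / 8 ≤ C.toReal := by
    intro k hk
    have hck : 0 < c k := mul_pos hk (by positivity)
    have hdist : ENNReal.ofReal (2 ^ k) ≤
        distFn (fun x => S (fun y => |dyadicStep c y|) x) (c k / 8) := by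
      calc ENNReal.ofReal (2 ^ k) ≤ volume (dyadicIco (k + 1)) := by
            rw [dyadicIco, Real.volume_Ico]
            refine ENNReal.ofReal_le_ofReal ?_
            have := pow_pos (two_pos : (0 : ℝ) < 2) k
            rw [pow_succ, pow_succ]; linarith
        _ ≤ _ := by
            refine measure_mono fun x hx => ⟨dyadicIco_subset_Ioi _ hx, ?_⟩
            have := le_S_dyadicStep hc hx
            exact (by linarith : c k / 8 < _).trans_le (le_abs_self _)
    have h1 := hbound (c k / 8) (by positivity)
    rw [← ENNReal.ofReal_le_iff_le_toReal hC.ne]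
    refine le_trans ?_ ((mul_le_mul_right (ENNReal.rpow_le_rpow hdist
      (by positivity : 0 ≤ 1 / p)) _).trans h1)
    rw [ENNReal.ofReal_rpow_of_pos (by positivity), ← ENNReal.ofReal_mul (by positivity)]
    refine ENNReal.ofReal_le_ofReal (le_of_eq ?_)
    rw [← Real.rpow_natCast, ← Real.rpow_mul (by norm_num), mul_one_div]
    simp only [c]
    rw [neg_div, Real.rpow_neg (by norm_num)]
    field_simp
  obtain ⟨N, hN⟩ := exists_nat_gt (8 * C.toReal)
  obtain ⟨k, hk⟩ := hunb N
  have h0 : 0 ≤ C.toReal := ENNReal.toReal_nonneg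
  have := hle k (by linarith)
  linarith

theorem lintegral_dyadicStep_mul (c : ℕ → ℝ) (v : ℝ → ℝ) :
    ∫⁻ t in Ioi (0 : ℝ), ENNReal.ofReal (|dyadicStep c t| * v t) =
      ∑' k, ENNReal.ofReal |c k| * ∫⁻ t in dyadicIco k, ENNReal.ofReal (v t) := by
  have hsub : Ici (1 : ℝ) ⊆ Ioi 0 := fun t (ht : 1 ≤ t) =>
    show 0 < t by linarith
  have hsupp : (fun t => ENNReal.ofReal (|dyadicStep c t| * v t)).support ⊆ Ici 1 := by
    intro t ht
    by_contra hlt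
    have h0 : dyadicStep c t = 0 := if_neg hlt
    exact ht (by simp [h0])
  rw [setLIntegral_eq_of_support_subset (hsupp.trans hsub),
    ← setLIntegral_eq_of_support_subset hsupp, setLIntegral_Ici_one_eq_tsum]
  refine tsum_congr fun k => ?_
  rw [← lintegral_const_mul' _ _ ENNReal.ofReal_ne_top]
  refine setLIntegral_congr_fun (measurableSet_dyadicIco k) fun t ht => ?_
  simp only [dyadicStep_of_mem c ht, ENNReal.ofReal_mul (abs_nonneg _)]

/-- The derivative of `x ↦ x ^ r / (2 / r + log x)` on `[1, ∞)`, extended by `0`. -/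
noncomputable def logDecay (r : ℝ) : ℝ → ℝ :=
  (Ici 1).indicator fun x =>
    x ^ (r - 1) * (r / (2 / r + Real.log x) - 1 / (2 / r + Real.log x) ^ 2)

theorem measurable_logDecay (r : ℝ) : Measurable (logDecay r) := by
  refine Measurable.indicator ?_ measurableSet_Ici
  have := Real.measurable_log
  fun_prop

theorem two_div_add_log_pos {r x : ℝ} (hr : 0 < r) (hx : 1 ≤ x) : 0 < 2 / r + Real.log x := by
  have := Real.log_nonneg hx
  positivity

theorem le_logDecay {r x : ℝ} (hr : 0 < r) (hx : 1 ≤ x) :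
    r / 2 * x ^ (r - 1) / (2 / r + Real.log x) ≤ logDecay r x := by
  have hx0 : 0 < x := by linarith
  have hA := two_div_add_log_pos hr hx
  have hlog := Real.log_nonneg hx
  rw [logDecay, indicator_of_mem (mem_Ici.2 hx)]
  have h1 : 1 / (2 / r + Real.log x) ≤ r / 2 := by
    rw [div_le_iff₀ hA]
    have : r / 2 * (2 / r) = 1 := by field_simp
    nlinarith
  calc r / 2 * x ^ (r - 1) / (2 / r + Real.log x)
      = x ^ (r - 1) * ((r - r / 2) / (2 / r + Real.log x)) := by ring
    _ ≤ x ^ (r - 1) * ((r - 1 / (2 / r + Real.log x)) / (2 / r + Real.log x)) := by gcongr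
    _ = _ := by rw [sub_div, div_div (1 : ℝ), sq]

theorem logDecay_nonneg {r : ℝ} (hr : 0 < r) (x : ℝ) : 0 ≤ logDecay r x := by
  by_cases hx : 1 ≤ x
  · have := two_div_add_log_pos hr hx
    have hx0 : 0 < x := by linarith
    exact le_trans (by positivity) (le_logDecay hr hx)
  · rw [logDecay, indicator_of_notMem (by simpa using hx)]

theorem hasDerivAt_rpow_div_log {r x : ℝ} (hr : 0 < r) (hx : 1 ≤ x) :
    HasDerivAt (fun x => x ^ r / (2 / r + Real.log x)) (logDecay r x) x := by
  have hx0 : 0 < x := by linarith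
  have hA := two_div_add_log_pos hr hx
  have h := (Real.hasDerivAt_rpow_const (p := r) (Or.inl hx0.ne')).div
    ((Real.hasDerivAt_log hx0.ne').const_add (2 / r)) hA.ne'
  refine h.congr_deriv ?_
  rw [logDecay, indicator_of_mem (mem_Ici.2 hx), Real.rpow_sub_one hx0.ne']
  field_simp

theorem continuousOn_logDecay {r : ℝ} (hr : 0 < r) : ContinuousOn (logDecay r) (Ici 1) := by
  have h : ContinuousOn (fun x : ℝ =>
      x ^ (r - 1) * (r / (2 / r + Real.log x) - 1 / (2 / r + Real.log x) ^ 2)) (Ici 1) := by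
    intro x hx
    have hx0 : x ≠ 0 := (zero_lt_one.trans_le (mem_Ici.1 hx)).ne'
    have hA := (two_div_add_log_pos hr hx).ne'
    have hlog := Real.continuousAt_log hx0
    refine ContinuousAt.continuousWithinAt ?_
    refine (Real.continuousAt_rpow_const _ _ (Or.inl hx0)).mul (ContinuousAt.sub ?_ ?_)
    · exact continuousAt_const.div (continuousAt_const.add hlog) hA
    · exact continuousAt_const.div ((continuousAt_const.add hlog).pow 2) (pow_ne_zero 2 hA)
  exact h.congr fun x hx => indicator_of_mem hx _

theorem integrableOn_logDecay {r : ℝ} (hr : 0 < r) (x : ℝ) :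
    IntegrableOn (logDecay r) (Ioo 0 x) := by
  have h1 : IntegrableOn (logDecay r) (Icc 1 x) :=
    ((continuousOn_logDecay hr).mono fun _ h => h.1).integrableOn_Icc
  have h2 : IntegrableOn (logDecay r) (Iio 1) :=
    integrableOn_zero.congr_fun
      (fun y hy => (indicator_of_notMem (fun h : y ∈ Ici 1 => not_le.2 hy h) _).symm)
      measurableSet_Iio
  exact (h2.union h1).mono_set fun y hy => (lt_or_ge y 1).imp id fun h => ⟨h, hy.2.le⟩

theorem S_logDecay_of_lt_one {r x : ℝ} (hx : x < 1) :
    S (fun y => |logDecay r y|) x = 0 := by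
  rw [S, setIntegral_eq_zero_of_forall_eq_zero, mul_zero]
  intro y hy
  rw [logDecay, indicator_of_notMem (fun h : y ∈ Ici 1 => not_le.2 (hy.2.trans hx) h), abs_zero]

theorem S_logDecay_nonneg {r x : ℝ} (hx : 0 < x) : 0 ≤ S (fun y => |logDecay r y|) x :=
  mul_nonneg (by positivity) (integral_nonneg fun _ => abs_nonneg _)

theorem S_logDecay_le {r x : ℝ} (hr : 0 < r) (hx : 1 ≤ x) :
    S (fun y => |logDecay r y|) x ≤ x ^ (r - 1) / (2 / r + Real.log x) := by
  have hx0 : 0 < x := by linarith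
  have hint : ∫ y in Ioo 0 x, |logDecay r y| ≤ x ^ r / (2 / r + Real.log x) := by
    calc ∫ y in Ioo 0 x, |logDecay r y| = ∫ y in Icc 1 x, logDecay r y := by
          simp only [abs_of_nonneg (logDecay_nonneg hr _)]
          rw [← integral_Ioc_eq_integral_Ioo]
          refine setIntegral_eq_of_subset_of_forall_sdiff_eq_zero measurableSet_Ioc
            (fun y hy => ⟨zero_lt_one.trans_le hy.1, hy.2⟩) fun y hy => ?_
          exact indicator_of_notMem (fun h : y ∈ Ici 1 => hy.2 ⟨h, hy.1.2⟩) _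
      _ = x ^ r / (2 / r + Real.log x) - 1 ^ r / (2 / r + Real.log 1) := by
          rw [integral_Icc_eq_integral_Ioc, ← intervalIntegral.integral_of_le hx]
          refine intervalIntegral.integral_eq_sub_of_hasDerivAt
            (f := fun x => x ^ r / (2 / r + Real.log x)) (fun y hy => ?_) ?_
          · rw [uIcc_of_le hx] at hy
            exact hasDerivAt_rpow_div_log hr hy.1
          · refine ContinuousOn.intervalIntegrable ((continuousOn_logDecay hr).mono ?_)
            rw [uIcc_of_le hx]
            exact fun _ h => h.1
      _ ≤ _ := sub_le_self _ (by rw [Real.log_one]; positivity)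
  rw [S, one_div_mul_eq_div, Real.rpow_sub_one hx0.ne', div_right_comm]
  gcongr

theorem distFn_S_logDecay_eq_zero {r s : ℝ} (hr : 0 < r) (hr1 : r ≤ 1) (hs : 1 ≤ s) :
    distFn (fun x => S (fun y => |logDecay r y|) x) s = 0 := by
  rw [distFn]
  convert measure_empty (μ := (volume : Measure ℝ))
  refine eq_empty_of_forall_notMem fun x hx => ?_
  obtain ⟨hx0, hx⟩ := hx
  rw [abs_of_nonneg (S_logDecay_nonneg hx0)] at hx
  rcases lt_or_ge x 1 with h | h
  · rw [S_logDecay_of_lt_one h] at hx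
    linarith
  · have h1 := S_logDecay_le hr h
    have h2 : x ^ (r - 1) ≤ 1 := Real.rpow_le_one_of_one_le_of_nonpos h (by linarith)
    have h3 : 1 ≤ 2 / r + Real.log x := by
      have := Real.log_nonneg h
      have : 1 ≤ 2 / r := by rw [le_div_iff₀ hr]; linarith
      linarith
    have h4 : x ^ (r - 1) / (2 / r + Real.log x) ≤ 1 :=
      div_le_one_of_le₀ (h2.trans h3) (by linarith)
    linarith

theorem distFn_S_logDecay_le {p s : ℝ} (hp : 1 < p) (hs : 0 < s) (hs1 : s < 1) :
    distFn (fun x => S (fun y => |logDecay (1 - 1 / p) y|) x) s ≤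
      ENNReal.ofReal (max (s ^ (-p / 2)) ((s * (1 - Real.log s / 2)) ^ (-p))) := by
  have hp0 : 0 < p := by linarith
  have hr : 0 < 1 - 1 / p := by
    rw [sub_pos, div_lt_one hp0]; exact hp
  have hr1 : 1 - 1 / p ≤ 1 := by
    have : 0 < 1 / p := by positivity
    linarith
  have hlogs : Real.log s < 0 := Real.log_neg hs hs1
  rw [← sub_zero (max _ _), ← Real.volume_Ioc, distFn]
  refine measure_mono fun x ⟨hx0, hx⟩ => ⟨hx0, ?_⟩
  rw [abs_of_nonneg (S_logDecay_nonneg hx0)] at hx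
  rw [mem_Ioi] at hx0
  have hx1 : 1 ≤ x := by
    by_contra! h
    rw [S_logDecay_of_lt_one h] at hx
    linarith
  have hA : 1 ≤ 2 / (1 - 1 / p) := by rw [le_div_iff₀ hr]; linarith
  have hlogx := Real.log_nonneg hx1
  have hlt := hx.trans_le (S_logDecay_le hr hx1)
  rw [show 1 - 1 / p - 1 = -(1 / p) by ring, Real.rpow_neg hx0.le, lt_div_iff₀ (by linarith),
    ← one_div, lt_div_iff₀ (by positivity)] at hlt
  rcases le_or_gt (Real.log x) (-p / 2 * Real.log s) with h | h
  · refine le_max_of_le_left ?_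
    rwa [← Real.log_le_log_iff hx0 (by positivity), Real.log_rpow hs]
  · refine le_max_of_le_right ?_
    have hl : 0 < s * (1 - Real.log s / 2) := mul_pos hs (by linarith)
    have h1 : 1 - Real.log s / 2 ≤ 2 / (1 - 1 / p) + Real.log x := by nlinarith
    have hxp : 0 < x ^ (1 / p) := by positivity
    have h2 : s * (1 - Real.log s / 2) * x ^ (1 / p) ≤ 1 :=
      le_trans (by gcongr) hlt.le
    rw [mul_comm, ← le_div_iff₀ hl, one_div (s * _)] at h2
    calc x = (x ^ (1 / p)) ^ p := by
          rw [← Real.rpow_mul hx0.le, one_div_mul_cancel hp0.ne', Real.rpow_one]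
      _ ≤ ((s * (1 - Real.log s / 2))⁻¹) ^ p := by gcongr
      _ = _ := by rw [Real.inv_rpow hl.le, Real.rpow_neg hl.le]

theorem distFn_S_logDecay_rpow_le {p s Q : ℝ} (hp : 1 < p) (hQ : 0 < Q) (hs : 0 < s)
    (hs1 : s < 1) :
    distFn (fun x => S (fun y => |logDecay (1 - 1 / p) y|) x) s ^ (Q / p) ≤
      ENNReal.ofReal (s ^ (-Q / 2) + s ^ (-Q) * (1 - Real.log s / 2) ^ (-Q)) := by
  have hp0 : 0 < p := by linarith
  have hl : 0 < 1 - Real.log s / 2 := by linarith [Real.log_neg hs hs1]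
  refine (ENNReal.rpow_le_rpow (distFn_S_logDecay_le hp hs hs1) (by positivity)).trans ?_
  rw [ENNReal.ofReal_rpow_of_nonneg (by positivity) (by positivity)]
  refine ENNReal.ofReal_le_ofReal ?_
  rw [← Real.mul_rpow hs.le hl.le]
  rcases max_choice (s ^ (-p / 2)) ((s * (1 - Real.log s / 2)) ^ (-p)) with h | h <;> rw [h]
  · rw [← Real.rpow_mul hs.le, show -p / 2 * (Q / p) = -Q / 2 by field_simp]
    exact le_add_of_nonneg_right (by positivity)
  · rw [← Real.rpow_mul (by positivity), show -p * (Q / p) = -Q by field_simp]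
    exact le_add_of_nonneg_left (by positivity)

theorem integrableOn_inv_mul_log_rpow {Q : ℝ} (hQ : 1 < Q) :
    IntegrableOn (fun s => s⁻¹ * (1 - Real.log s / 2) ^ (-Q)) (Ioc 0 1) := by
  let G : ℝ → ℝ := fun s => 2 / (Q - 1) * (1 - Real.log s / 2) ^ (1 - Q)
  have hl : ∀ s ∈ Ioc (0 : ℝ) 1, 0 < 1 - Real.log s / 2 := fun s hs => by
    linarith [Real.log_nonpos hs.1.le hs.2]
  have hderiv : ∀ s ∈ Ioc (0 : ℝ) 1,
      HasDerivAt G (s⁻¹ * (1 - Real.log s / 2) ^ (-Q)) s := fun s hs => by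
    have h := ((((Real.hasDerivAt_log hs.1.ne').div_const 2).const_sub 1).rpow_const
      (p := 1 - Q) (Or.inl (hl s hs).ne')).const_mul (2 / (Q - 1))
    refine h.congr_deriv ?_
    rw [show 1 - Q - 1 = -Q by ring]
    have : Q - 1 ≠ 0 := by linarith
    field_simp
    ring
  have hlim : Filter.Tendsto G (nhdsWithin 0 (Ioi 0)) (nhds 0) := by
    have h1 : Filter.Tendsto (fun s => 1 - Real.log s / 2) (nhdsWithin 0 (Ioi 0)) Filter.atTop := by
      have := (Filter.tendsto_neg_atBot_atTop.comp Real.tendsto_log_nhdsGT_zero).const_mul_atTop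
        (by norm_num : (0 : ℝ) < 1 / 2)
      refine (Filter.tendsto_atTop_add_const_left _ 1 this).congr fun s => ?_
      simp only [Function.comp]
      ring
    have h2 := ((tendsto_rpow_neg_atTop (by linarith : 0 < Q - 1)).comp h1).const_mul (2 / (Q - 1))
    simpa [G, Function.comp_def] using h2
  refine intervalIntegral.integrableOn_deriv_of_nonneg (g := Function.update G 0 0) ?_ ?_ ?_
  · intro s hs
    rcases hs.1.eq_or_lt with rfl | h0
    · rw [continuousWithinAt_update_same]
      exact hlim.mono_left (nhdsWithin_mono _ fun y hy => lt_of_le_of_ne hy.1.1 (Ne.symm hy.2))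
    · rw [continuousWithinAt_update_of_ne h0.ne']
      exact (hderiv s ⟨h0, hs.2⟩).continuousAt.continuousWithinAt
  · intro s hs
    refine (hderiv s ⟨hs.1, hs.2.le⟩).congr_of_eventuallyEq ?_
    filter_upwards [isOpen_ne.mem_nhds hs.1.ne'] with y hy
    exact Function.update_of_ne hy _ _
  · intro s hs
    have := hl s ⟨hs.1, hs.2.le⟩
    have := hs.1
    positivity

theorem memLpq_S_logDecay {p : ℝ} {q : ℝ≥0∞} (hp : 1 < p) (hq : 1 < q) :
    MemLpq p q (fun x => S (fun y => |logDecay (1 - 1 / p) y|) x) := by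
  have hp0 : 0 < p := by linarith
  have hr : 0 < 1 - 1 / p := by
    rw [sub_pos, div_lt_one hp0]; exact hp
  have hr1 : 1 - 1 / p ≤ 1 := by
    have : 0 < 1 / p := by positivity
    linarith
  have hzero : ∀ s Q : ℝ, 0 < Q → 1 ≤ s →
      distFn (fun x => S (fun y => |logDecay (1 - 1 / p) y|) x) s ^ (Q / p) = 0 := by
    intro s Q hQ hs
    rw [distFn_S_logDecay_eq_zero hr hr1 hs, ENNReal.zero_rpow_of_pos (by positivity)]
  unfold MemLpq
  split_ifs with hqt
  · refine lt_of_le_of_lt (iSup₂_le fun s hs => ?_) (ENNReal.ofReal_lt_top (r := 2))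
    rcases lt_or_ge s 1 with h | h
    · have hs0 : 0 < s := hs
      refine (mul_le_mul_right (distFn_S_logDecay_rpow_le hp one_pos hs h) _).trans ?_
      rw [← ENNReal.ofReal_mul hs0.le]
      refine ENNReal.ofReal_le_ofReal ?_
      have hl : 1 ≤ 1 - Real.log s / 2 := by linarith [Real.log_neg hs0 h]
      have h1 : s * s ^ (-1 / 2 : ℝ) ≤ 1 := by
        rw [mul_comm, ← Real.rpow_add_one hs0.ne']
        exact Real.rpow_le_one hs0.le h.le (by norm_num)
      have h2 : (1 - Real.log s / 2) ^ (-1 : ℝ) ≤ 1 :=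
        Real.rpow_le_one_of_one_le_of_nonpos hl (by norm_num)
      rw [mul_add, ← mul_assoc, Real.rpow_neg_one s, mul_inv_cancel₀ hs0.ne']
      linarith
    · rw [hzero s 1 one_pos h]
      simp
  · set Q := q.toReal
    have hQ : 1 < Q := by
      rw [← ENNReal.toReal_one]
      exact (ENNReal.toReal_lt_toReal (by simp) hqt).2 hq
    have hQ0 : 0 < Q := by linarith
    have hint : IntegrableOn
        (fun s : ℝ => s ^ (Q / 2 - 1) + s⁻¹ * (1 - Real.log s / 2) ^ (-Q)) (Ioc 0 1) :=
      ((intervalIntegrable_iff_integrableOn_Ioc_of_le zero_le_one).1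
        (intervalIntegral.intervalIntegrable_rpow' (by linarith))).add
        (integrableOn_inv_mul_log_rpow hQ)
    refine lt_of_le_of_lt ?_ hint.lintegral_lt_top
    rw [← lintegral_indicator measurableSet_Ioc]
    refine (setLIntegral_mono' measurableSet_Ioi fun s hs => ?_).trans
      (setLIntegral_le_lintegral _ _)
    have hs0 : 0 < s := hs
    rcases lt_or_ge s 1 with h | h
    · rw [indicator_of_mem (show s ∈ Ioc (0 : ℝ) 1 from ⟨hs0, h.le⟩)]
      refine (mul_le_mul_right (distFn_S_logDecay_rpow_le hp hQ0 hs0 h) _).trans ?_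
      rw [← ENNReal.ofReal_mul (by positivity), mul_add, ← mul_assoc, ← Real.rpow_add hs0,
        ← Real.rpow_add hs0, ← Real.rpow_neg_one s]
      refine le_of_eq ?_
      ring_nf
    · rw [hzero s Q hQ0 h, mul_zero]
      exact zero_le

theorem exists_le_logDecay {r : ℝ} (hr : 0 < r) (hr1 : r ≤ 1) :
    ∃ δ > 0, ∀ k, ∀ t ∈ dyadicIco k, δ / (k + 1) * 2 ^ ((k : ℝ) * (r - 1)) ≤ logDecay r t := by
  refine ⟨r / 2 * 2 ^ (r - 1) / (2 / r + 1), by positivity, fun k t ht => ?_⟩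
  have ht1 := one_le_of_mem_dyadicIco ht
  have ht0 : 0 < t := by linarith
  refine le_trans ?_ (le_logDecay hr ht1)
  have hpow : (2 : ℝ) ^ (r - 1) * 2 ^ ((k : ℝ) * (r - 1)) ≤ t ^ (r - 1) := by
    calc (2 : ℝ) ^ (r - 1) * 2 ^ ((k : ℝ) * (r - 1)) = (2 ^ (k + 1)) ^ (r - 1) := by
          rw [← Real.rpow_natCast, ← Real.rpow_mul (by norm_num), ← Real.rpow_add (by norm_num)]
          push_cast
          ring_nf
      _ ≤ _ := Real.rpow_le_rpow_of_nonpos ht0 ht.2.le (by linarith)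
  have hlog : 2 / r + Real.log t ≤ (2 / r + 1) * (k + 1) := by
    have h1 : Real.log t ≤ (k + 1) * 1 := by
      calc Real.log t ≤ Real.log (2 ^ (k + 1)) := Real.log_le_log ht0 ht.2.le
        _ = (k + 1) * Real.log 2 := by rw [Real.log_pow]; push_cast; rfl
        _ ≤ _ := by gcongr; linarith [Real.log_two_lt_d9]
    have : 0 ≤ 2 / r * k := by positivity
    linarith
  have hA := two_div_add_log_pos hr ht1
  calc r / 2 * 2 ^ (r - 1) / (2 / r + 1) / (k + 1) * 2 ^ ((k : ℝ) * (r - 1))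
      = r / 2 * (2 ^ (r - 1) * 2 ^ ((k : ℝ) * (r - 1))) / ((2 / r + 1) * (k + 1)) := by
        field_simp
    _ ≤ _ := by gcongr

/-- If `u` does not stay away from `0`, some unbounded sequence is summable against it. -/
theorem exists_unbounded_tsum_mul_lt_top {u : ℕ → ℝ≥0∞}
    (hu : ∀ n : ℕ, ∃ᶠ k in Filter.atTop, n * u k ≤ 2⁻¹ ^ n) :
    ∃ b : ℕ → ℝ, (∀ k, 0 ≤ b k) ∧ (∀ N : ℕ, ∃ k, (N : ℝ) ≤ b k) ∧
      ∑' k, ENNReal.ofReal (b k) * u k < ⊤ := by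
  obtain ⟨φ, hφ, hle⟩ := Filter.extraction_forall_of_frequently hu
  have hinj := hφ.injective
  refine ⟨Function.extend φ (fun n => (n : ℝ)) 0, fun k => ?_, fun N => ⟨φ N, ?_⟩, ?_⟩
  · by_cases hk : ∃ n, φ n = k
    · obtain ⟨n, rfl⟩ := hk
      rw [hinj.extend_apply]
      positivity
    · rw [Function.extend_apply' _ _ _ hk, Pi.zero_apply]
  · rw [hinj.extend_apply]
  · have heq : (fun k => ENNReal.ofReal (Function.extend φ (fun n => (n : ℝ)) 0 k) * u k) =
        Function.extend φ (fun n => (n : ℝ≥0∞) * u (φ n)) 0 := by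
      ext k
      by_cases hk : ∃ n, φ n = k
      · obtain ⟨n, rfl⟩ := hk
        rw [hinj.extend_apply, hinj.extend_apply, ENNReal.ofReal_natCast]
      · rw [Function.extend_apply' _ _ _ hk, Function.extend_apply' _ _ _ hk]
        simp
    rw [heq, tsum_extend_zero hinj]
    refine (ENNReal.tsum_le_tsum hle).trans_lt ?_
    rw [ENNReal.tsum_geometric, ENNReal.one_sub_inv_two, inv_inv]
    simp

theorem tsum_div_mul_eq_top {u : ℕ → ℝ≥0∞} {ε : ℝ≥0∞} (hε : ε ≠ 0)
    (hu : ∀ᶠ k in Filter.atTop, ε ≤ u k) {δ : ℝ} (hδ : 0 < δ) :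
    ∑' k : ℕ, ENNReal.ofReal (δ / (k + 1)) * u k = ⊤ := by
  obtain ⟨K, hK⟩ := Filter.eventually_atTop.1 hu
  by_contra hne
  have h1 : (∑' k : ℕ, ENNReal.ofReal (δ / ((k + K : ℕ) + 1))) * ε ≠ ⊤ := by
    refine ne_top_of_le_ne_top hne ?_
    rw [← ENNReal.tsum_mul_right]
    calc ∑' k : ℕ, ENNReal.ofReal (δ / ((k + K : ℕ) + 1)) * ε
        ≤ ∑' k : ℕ, ENNReal.ofReal (δ / ((k + K : ℕ) + 1)) * u (k + K) :=
          ENNReal.tsum_le_tsum fun k => by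
            gcongr
            exact hK _ (Nat.le_add_left _ _)
      _ ≤ _ := ENNReal.tsum_comp_le_tsum_of_injective (add_left_injective K)
          fun k : ℕ => ENNReal.ofReal (δ / (k + 1)) * u k
  have h2 : ∑' k : ℕ, ENNReal.ofReal (δ / ((k + K : ℕ) + 1)) ≠ ⊤ := fun h =>
    h1 (by rw [h, ENNReal.top_mul hε])
  have h3 := (ENNReal.summable_toReal h2).mul_left δ⁻¹
  refine Real.not_summable_natCast_inv ((summable_nat_add_iff (K + 1)).1 (h3.congr fun k => ?_))
  rw [ENNReal.toReal_ofReal (by positivity)]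
  push_cast
  field_simp
  ring

/-- For `1 < p < ∞` and `1 < q ≤ ∞`, there is no nonnegative locally integrable weight `v`
on `(0,∞)` such that, for every measurable locally integrable `f`,
`S|f| ∈ L^{p,q}` iff `∫₀^∞ |f(t)|·v(t) dt < ∞`:
the optimal domain `[S, L^{p,q}]` is not a weighted `L¹` space. -/
theorem hardy_domain_Lpq_not_weighted_L1 (p : ℝ) (hp : 1 < p) (q : ℝ≥0∞) (hq : 1 < q) :
    ¬ ∃ v : ℝ → ℝ, (∀ t ∈ Ioi (0 : ℝ), 0 ≤ v t) ∧
      LocallyIntegrableOn v (Ioi 0) ∧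
      ∀ f : ℝ → ℝ, Measurable f → (∀ x > (0 : ℝ), IntegrableOn f (Ioo 0 x)) →
        (MemLpq p q (fun x => S (fun y => |f y|) x) ↔
          (∫⁻ t in Ioi (0 : ℝ), ENNReal.ofReal (|f t| * v t)) < ⊤) := by
  rintro ⟨v, -, -, hiff⟩
  have hp0 : 0 < p := by linarith
  set u : ℕ → ℝ≥0∞ := fun k =>
    ENNReal.ofReal (2 ^ (-(k : ℝ) / p)) * ∫⁻ t in dyadicIco k, ENNReal.ofReal (v t)
  by_cases hu : ∀ n : ℕ, ∃ᶠ k in Filter.atTop, n * u k ≤ 2⁻¹ ^ n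
  · obtain ⟨b, hb, hunb, hsum⟩ := exists_unbounded_tsum_mul_lt_top hu
    refine not_memLpq_S_dyadicStep hp0 hq hb hunb
      ((hiff _ (measurable_dyadicStep _) fun x _ => integrableOn_dyadicStep _ x).2 ?_)
    rw [lintegral_dyadicStep_mul]
    refine lt_of_eq_of_lt (tsum_congr fun k => ?_) hsum
    rw [abs_of_nonneg (mul_nonneg (hb k) (by positivity)), ENNReal.ofReal_mul (hb k), mul_assoc]
  · push Not at hu
    obtain ⟨n, hn⟩ := hu
    have hr : 0 < 1 - 1 / p := by
      rw [sub_pos, div_lt_one hp0]; exact hp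
    have hr1 : 1 - 1 / p ≤ 1 := by
      have : 0 < 1 / p := by positivity
      linarith
    obtain ⟨δ, hδ, hle⟩ := exists_le_logDecay hr hr1
    have hε : (2⁻¹ ^ n / n : ℝ≥0∞) ≠ 0 := by simp
    have hεu : ∀ᶠ k in Filter.atTop, (2⁻¹ ^ n / n : ℝ≥0∞) ≤ u k :=
      hn.mono fun k hk => ENNReal.div_le_of_le_mul' hk.le
    refine ((hiff _ (measurable_logDecay _) fun x _ => integrableOn_logDecay hr x).1
      (memLpq_S_logDecay hp hq)).ne (top_le_iff.1 ?_)
    rw [← tsum_div_mul_eq_top hε hεu hδ]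
    calc ∑' k : ℕ, ENNReal.ofReal (δ / (k + 1)) * u k
        ≤ ∑' k, ∫⁻ t in dyadicIco k, ENNReal.ofReal (|logDecay (1 - 1 / p) t| * v t) := by
          refine ENNReal.tsum_le_tsum fun k => ?_
          rw [← mul_assoc, ← ENNReal.ofReal_mul (by positivity),
            ← lintegral_const_mul' _ _ ENNReal.ofReal_ne_top]
          refine setLIntegral_mono' (measurableSet_dyadicIco k) fun t ht => ?_
          rw [ENNReal.ofReal_mul (abs_nonneg _)]
          gcongr
          refine le_trans (le_of_eq ?_) ((hle k t ht).trans (le_abs_self _))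
          ring_nf
      _ = ∫⁻ t in Ici 1, ENNReal.ofReal (|logDecay (1 - 1 / p) t| * v t) :=
          (setLIntegral_Ici_one_eq_tsum _).symm
      _ ≤ _ := lintegral_mono_set fun t (ht : 1 ≤ t) => show 0 < t by linarith
end

section
/- Fix 1 < p < ∞ and let v : (0,∞) → [0,∞) be measurable with ∫₀^∞ v(t)·t^{−1/p} dt < ∞. If f : (0,∞) → [0,∞) is nonincreasing and Sf ∈ L^{p,∞}(0,∞) (i.e. sup_{s>0} s·λ_{Sf}(s)^{1/p} < ∞), then ∫₀^∞ f(t)·v(t) dt < ∞. (That is, under condition ∫₀^∞ v(t) t^{−1/p} dt < ∞, every nonincreasing function in the optimal domain [S, L^{p,∞}] belongs to the weighted space L¹(v(t) dt).) -/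
open MeasureTheory Set
open scoped ENNReal

/-- A nonincreasing function is dominated by its Hardy average. -/
theorem AntitoneOn.le_hardy {f : ℝ → ℝ} (hf : AntitoneOn f (Ioi 0)) {x : ℝ} (hx : 0 < x)
    (hint : IntegrableOn f (Ioo 0 x)) : f x ≤ S f x := by
  have h : ∫ _ in Ioo (0 : ℝ) x, f x ≤ ∫ y in Ioo (0 : ℝ) x, f y :=
    setIntegral_mono_on (by simp) hint measurableSet_Ioo
      fun y hy => hf hy.1 hx hy.2.le
  have hconst : ∫ _ in Ioo (0 : ℝ) x, f x = x * f x := by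
    simp [hx.le]
  rw [S, one_div, ← div_eq_inv_mul, le_div_iff₀ hx, mul_comm, ← hconst]
  exact h

/-- If `f` is nonincreasing, then `{x > 0 : |S f x| > s}` contains `(0, t]` whenever `s < f t`. -/
theorem AntitoneOn.ofReal_le_distFn_hardy {f : ℝ → ℝ} (hf : AntitoneOn f (Ioi 0))
    (hint : ∀ x > (0 : ℝ), IntegrableOn f (Ioo 0 x)) {s t : ℝ} (ht : 0 < t) (hs : s < f t) :
    ENNReal.ofReal t ≤ distFn (S f) s := by
  have hsub : Ioc 0 t ⊆ {x | x ∈ Ioi (0 : ℝ) ∧ s < |S f x|} := fun x hx =>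
    ⟨hx.1, hs.trans_le <| (hf hx.1 ht hx.2).trans <|
      (hf.le_hardy hx.1 (hint x hx.1)).trans (le_abs_self _)⟩
  simpa [distFn] using measure_mono (μ := volume) hsub

/-- A nonincreasing function whose Hardy average is in weak `L^p` is `O(t ^ (-1/p))`. -/
theorem AntitoneOn.le_rpow_of_hardy_weak {f : ℝ → ℝ} {p : ℝ} (hp : 0 < p)
    (hf : AntitoneOn f (Ioi 0)) (hint : ∀ x > (0 : ℝ), IntegrableOn f (Ioo 0 x))
    (hSf : (⨆ s ∈ Ioi (0 : ℝ), ENNReal.ofReal s * (distFn (S f) s) ^ (1 / p)) < ⊤) :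
    ∃ C : ℝ, 0 ≤ C ∧ ∀ t > 0, f t ≤ C * t ^ (-(1 / p)) := by
  set M := ⨆ s ∈ Ioi (0 : ℝ), ENNReal.ofReal s * (distFn (S f) s) ^ (1 / p)
  refine ⟨M.toReal, ENNReal.toReal_nonneg, fun t ht => le_of_forall_lt_imp_le_of_dense ?_⟩
  intro s hst
  obtain hs | hs := le_or_gt s 0
  · exact hs.trans (by positivity)
  have hweak : ENNReal.ofReal s * ENNReal.ofReal t ^ (1 / p) ≤ M :=
    calc ENNReal.ofReal s * ENNReal.ofReal t ^ (1 / p)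
        ≤ ENNReal.ofReal s * (distFn (S f) s) ^ (1 / p) := by
          gcongr
          exact hf.ofReal_le_distFn_hardy hint ht hst
      _ ≤ M := le_iSup₂_of_le s hs le_rfl
  rw [ENNReal.ofReal_rpow_of_pos ht, ← ENNReal.ofReal_mul hs.le,
    ENNReal.ofReal_le_iff_le_toReal hSf.ne] at hweak
  rwa [Real.rpow_neg ht.le, ← div_eq_mul_inv, le_div_iff₀ (by positivity)]

/-- For `1 < p < ∞` and a nonnegative measurable weight `v` with
`∫₀^∞ v(t)·t^{-1/p} dt < ∞`: every nonincreasing (locally integrable)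
`f : (0,∞) → [0,∞)` with `S f ∈ L^{p,∞}` (i.e. `sup_{s>0} s·λ_{Sf}(s)^{1/p} < ∞`)
satisfies `∫₀^∞ f(t)·v(t) dt < ∞`; that is, every nonincreasing function in the optimal
domain `[S, L^{p,∞}]` belongs to `L¹(v(t) dt)`. -/
theorem antitone_in_hardy_domain_Lpinfty_mem_weighted_L1 (p : ℝ) (hp : 1 < p)
    (v : ℝ → ℝ) (hvmeas : Measurable v) (hvnn : ∀ t ∈ Ioi (0 : ℝ), 0 ≤ v t)
    (hv : (∫⁻ t in Ioi (0 : ℝ), ENNReal.ofReal (v t * t ^ (-(1 / p)))) < ⊤)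
    (f : ℝ → ℝ) (hfmeas : Measurable f) (hfnn : ∀ x ∈ Ioi (0 : ℝ), 0 ≤ f x)
    (hfanti : AntitoneOn f (Ioi 0))
    (hfloc : ∀ x > (0 : ℝ), IntegrableOn f (Ioo 0 x))
    (hSf : (⨆ s ∈ Ioi (0 : ℝ), ENNReal.ofReal s * (distFn (S f) s) ^ (1 / p)) < ⊤) :
    (∫⁻ t in Ioi (0 : ℝ), ENNReal.ofReal (f t * v t)) < ⊤ := by
  obtain ⟨C, hC, hfC⟩ := hfanti.le_rpow_of_hardy_weak (zero_lt_one.trans hp) hfloc hSf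
  calc ∫⁻ t in Ioi (0 : ℝ), ENNReal.ofReal (f t * v t)
      ≤ ∫⁻ t in Ioi (0 : ℝ), ENNReal.ofReal C * ENNReal.ofReal (v t * t ^ (-(1 / p))) := by
        refine setLIntegral_mono' measurableSet_Ioi fun t ht => ?_
        rw [← ENNReal.ofReal_mul hC]
        refine ENNReal.ofReal_le_ofReal ?_
        calc f t * v t ≤ C * t ^ (-(1 / p)) * v t :=
              mul_le_mul_of_nonneg_right (hfC t ht) (hvnn t ht)
          _ = C * (v t * t ^ (-(1 / p))) := by ring
    _ = ENNReal.ofReal C * ∫⁻ t in Ioi (0 : ℝ), ENNReal.ofReal (v t * t ^ (-(1 / p))) :=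
        lintegral_const_mul' _ _ ENNReal.ofReal_ne_top
    _ < ⊤ := ENNReal.mul_lt_top ENNReal.ofReal_lt_top hv
end
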